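/- arXiv:1306.6807 — 3 statements merged into one kernel-verified Lean document; each statement's English description precedes it below -/
import Mathlib

section
/- Let C ⊆ ℝⁿ be a nonempty closed convex set and let P_C be the metric projection onto C. Then the function f(x) = ½·dist(x, C)² is differentiable on ℝⁿ with gradient ∇f(x) = x − P_C(x) for every x ∈ ℝⁿ. -/
section Projection

variable {E : Type*} [NormedAddCommGroup E] [InnerProductSpace ℝ E]

open scoped InnerProductSpace

/-- Variational inequality for a nearest point `p` of a convex set. -/
lemma inner_sub_le_zero_of_norm_eq_infDist {C : Set E} (hC : Convex ℝ C) {x p w : E}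
    (hp : p ∈ C) (hd : ‖x - p‖ = Metric.infDist x C) (hw : w ∈ C) :
    ⟪x - p, w - p⟫_ℝ ≤ 0 := by
  refine (norm_eq_iInf_iff_real_inner_le_zero hC hp).1 ?_ w hw
  simp only [hd, Metric.infDist_eq_iInf, dist_eq_norm]

/-- A function whose first-order remainder at `x` is quadratically bounded has the
corresponding gradient. -/
lemma hasGradientAt_of_abs_sub_le [CompleteSpace E] {f : E → ℝ} {g x : E} {K : ℝ}
    (h : ∀ y, |f y - f x - ⟪g, y - x⟫_ℝ| ≤ K * ‖y - x‖ ^ 2) : HasGradientAt f g x := by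
  rw [hasGradientAt_iff_isLittleO]
  refine (Asymptotics.IsBigO.of_bound K (.of_forall fun y => ?_)).trans_isLittleO
    (Asymptotics.isLittleO_pow_sub_sub x one_lt_two)
  simpa using h y

end Projection

/-- For a nonempty closed convex `C ⊆ ℝⁿ` with metric projection `P_C`,
the function `f(x) = ½ dist(x, C)²` is differentiable with gradient `∇f(x) = x − P_C(x)`. -/
theorem stmt_2 {n : ℕ} (C : Set (EuclideanSpace ℝ (Fin n)))
    (hCne : C.Nonempty) (hCclosed : IsClosed C) (hCconv : Convex ℝ C)
    (PC : EuclideanSpace ℝ (Fin n) → EuclideanSpace ℝ (Fin n))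
    (hPmem : ∀ x, PC x ∈ C)
    (hPdist : ∀ x, ‖x - PC x‖ = Metric.infDist x C) :
    ∀ x, HasGradientAt (fun y => (1 / 2 : ℝ) * Metric.infDist y C ^ 2) (x - PC x) x := by
  intro x
  refine hasGradientAt_of_abs_sub_le (K := 1 / 2) fun y => ?_
  have hupper : Metric.infDist y C ≤ ‖y - PC x‖ := by
    simpa [dist_eq_norm] using Metric.infDist_le_dist_of_mem (x := y) (hPmem x)
  have hupper_sq := pow_le_pow_left₀ Metric.infDist_nonneg hupper 2
  have hvar := inner_sub_le_zero_of_norm_eq_infDist hCconv (hPmem x) (hPdist x) (hPmem y)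
  have hx : y - PC x = (x - PC x) + (y - x) := by abel
  have hy : y - PC y = (x - PC x) + ((y - x) - (PC y - PC x)) := by abel
  have hy_sq := norm_add_sq_real (x - PC x) ((y - x) - (PC y - PC x))
  rw [← hy, hPdist y, inner_sub_right] at hy_sq
  rw [hx, norm_add_sq_real] at hupper_sq
  rw [← hPdist x, abs_le]
  constructor
  · nlinarith [sq_nonneg ‖(y - x) - (PC y - PC x)‖, sq_nonneg ‖y - x‖]
  · linarith
end

section
/- Let C₁, …, C_N ⊆ ℝⁿ be nonempty closed convex sets with ⋂ᵢ Cᵢ ≠ ∅, with metric projections P_{Cᵢ}, and let B ⊆ ℝⁿ be a set on which C₁,…,C_N are boundedly linearly regular with constant θ ≥ 1, i.e. dist(v, ⋂ᵢCᵢ) ≤ θ·maxᵢ dist(v, Cᵢ) for all v ∈ B. Let α₁,…,α_N > 0 with Σᵢ αᵢ = 1 and suppose v ∈ B with v^+ := Σ_{i=1}^N αᵢ·P_{Cᵢ}(v) (one step of the mean projection algorithm). Then dist(v^+, ⋂ᵢ Cᵢ) ≤ γ·dist(v, ⋂ᵢ Cᵢ), where γ = √(1 − (minᵢ αᵢ)/θ²).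 -/
/-- The Pythagorean inequality for a nearest point of a convex set. -/
theorem norm_sub_sq_add_norm_sub_sq_le_of_norm_eq_infDist {E : Type*} [NormedAddCommGroup E]
    [InnerProductSpace ℝ E] {K : Set E} (hK : Convex ℝ K) {x p z : E} (hp : p ∈ K)
    (hxp : ‖x - p‖ = Metric.infDist x K) (hz : z ∈ K) :
    ‖x - p‖ ^ 2 + ‖p - z‖ ^ 2 ≤ ‖x - z‖ ^ 2 := by
  have h : ‖x - p‖ = ⨅ w : K, ‖x - w‖ := by
    simpa only [Metric.infDist_eq_iInf, dist_eq_norm] using hxp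
  have hinner := (norm_eq_iInf_iff_real_inner_le_zero hK hp).1 h z hz
  have hadd := norm_sub_sq_real (x - p) (z - p)
  rw [sub_sub_sub_cancel_right, norm_sub_rev z p] at hadd
  linarith

/-- Jensen's inequality for the squared norm. -/
theorem norm_sum_smul_sq_le {ι E : Type*} [NormedAddCommGroup E] [NormedSpace ℝ E]
    (s : Finset ι) {a : ι → ℝ} (ha : ∀ i ∈ s, 0 ≤ a i) (hsum : ∑ i ∈ s, a i = 1) (f : ι → E) :
    ‖∑ i ∈ s, a i • f i‖ ^ 2 ≤ ∑ i ∈ s, a i * ‖f i‖ ^ 2 := by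
  have hconv : ConvexOn ℝ Set.univ fun x : E => ‖x‖ ^ 2 :=
    convexOn_univ_norm.pow (fun _ _ => norm_nonneg _) 2
  simpa using hconv.map_sum_le (p := f) ha hsum fun _ _ => Set.mem_univ _

/-- One step of the mean projection algorithm contracts the distance to the
intersection: if `C₁,…,C_N` are nonempty closed convex sets with nonempty intersection,
boundedly linearly regular on `B` with constant `θ ≥ 1`, `αᵢ > 0` sum to 1, `v ∈ B` and
`v⁺ = Σᵢ αᵢ P_{Cᵢ}(v)`, then `dist(v⁺, ⋂ᵢCᵢ) ≤ √(1 − (minᵢ αᵢ)/θ²) · dist(v, ⋂ᵢCᵢ)`. -/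
theorem stmt_15 {n N : ℕ} (hN : 0 < N)
    (C : Fin N → Set (EuclideanSpace ℝ (Fin n)))
    (hCne : ∀ i, (C i).Nonempty) (hCclosed : ∀ i, IsClosed (C i))
    (hCconv : ∀ i, Convex ℝ (C i)) (hInter : (⋂ i, C i).Nonempty)
    (P : Fin N → EuclideanSpace ℝ (Fin n) → EuclideanSpace ℝ (Fin n))
    (hPmem : ∀ i x, P i x ∈ C i)
    (hPdist : ∀ i x, ‖x - P i x‖ = Metric.infDist x (C i))
    (B : Set (EuclideanSpace ℝ (Fin n))) (θ : ℝ) (hθ : 1 ≤ θ)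
    (hreg : ∀ v ∈ B, Metric.infDist v (⋂ i, C i) ≤
      θ * Finset.univ.sup' (Finset.univ_nonempty_iff.mpr ⟨⟨0, hN⟩⟩)
        (fun i => Metric.infDist v (C i)))
    (α : Fin N → ℝ) (hαpos : ∀ i, 0 < α i) (hαsum : ∑ i, α i = 1)
    (v : EuclideanSpace ℝ (Fin n)) (hv : v ∈ B) :
    Metric.infDist (∑ i, α i • P i v) (⋂ i, C i) ≤
      Real.sqrt (1 - Finset.univ.inf' (Finset.univ_nonempty_iff.mpr ⟨⟨0, hN⟩⟩) α / θ ^ 2) *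
        Metric.infDist v (⋂ i, C i) := by
  obtain ⟨z, hz, hvz⟩ := (isClosed_iInter hCclosed).exists_infDist_eq_dist hInter v
  have hne : (Finset.univ : Finset (Fin N)).Nonempty :=
    Finset.univ_nonempty_iff.mpr ⟨⟨0, hN⟩⟩
  have hθ0 : 0 < θ := by linarith
  have hθ2 : 0 < θ ^ 2 := by positivity
  set m := Finset.univ.inf' hne α
  obtain ⟨j, -, hj⟩ := Finset.exists_mem_eq_sup' hne fun i => Metric.infDist v (C i)
  have hm_le : ∀ i, m ≤ α i := fun i => Finset.inf'_le _ (Finset.mem_univ i)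
  have hm_pos : 0 < m := (Finset.lt_inf'_iff hne).2 fun i _ => hαpos i
  have hα_le : α j ≤ 1 :=
    hαsum ▸ Finset.single_le_sum (fun i _ => (hαpos i).le) (Finset.mem_univ j)
  have hm_div : m / θ ^ 2 ≤ 1 := by
    rw [div_le_one hθ2]
    nlinarith [hm_le j]
  set d := Metric.infDist v (⋂ i, C i)
  have hd0 : 0 ≤ d := Metric.infDist_nonneg
  have hd_le : d ≤ θ * ‖v - P j v‖ := by
    rw [hPdist, ← hj]
    exact hreg v hv
  have hdvz : ‖v - z‖ = d := by rw [hvz, dist_eq_norm]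
  have hfar : m / θ ^ 2 * d ^ 2 ≤ ∑ i, α i * ‖v - P i v‖ ^ 2 :=
    calc m / θ ^ 2 * d ^ 2 ≤ m / θ ^ 2 * (θ * ‖v - P j v‖) ^ 2 := by gcongr
      _ = m * ‖v - P j v‖ ^ 2 := by field_simp
      _ ≤ α j * ‖v - P j v‖ ^ 2 := by gcongr; exact hm_le j
      _ ≤ ∑ i, α i * ‖v - P i v‖ ^ 2 :=
        Finset.single_le_sum (f := fun i => α i * ‖v - P i v‖ ^ 2)
          (fun i _ => mul_nonneg (hαpos i).le (sq_nonneg _)) (Finset.mem_univ j)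
  have hpyth : ∑ i, α i * ‖v - P i v‖ ^ 2 + ∑ i, α i * ‖P i v - z‖ ^ 2 ≤ d ^ 2 :=
    calc _ = ∑ i, α i * (‖v - P i v‖ ^ 2 + ‖P i v - z‖ ^ 2) := by
          simp only [mul_add, Finset.sum_add_distrib]
      _ ≤ ∑ i, α i * d ^ 2 := by
          refine Finset.sum_le_sum fun i _ => mul_le_mul_of_nonneg_left ?_ (hαpos i).le
          rw [← hdvz]
          exact norm_sub_sq_add_norm_sub_sq_le_of_norm_eq_infDist (hCconv i) (hPmem i v)
            (hPdist i v) (Set.mem_iInter.1 hz i)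
      _ = d ^ 2 := by rw [← Finset.sum_mul, hαsum, one_mul]
  have hstep : ∑ i, α i • P i v - z = ∑ i, α i • (P i v - z) := by
    simp only [smul_sub, Finset.sum_sub_distrib, ← Finset.sum_smul, hαsum, one_smul]
  have hjensen := norm_sum_smul_sq_le Finset.univ (fun i _ => (hαpos i).le) hαsum
    fun i => P i v - z
  calc Metric.infDist (∑ i, α i • P i v) (⋂ i, C i) ≤ ‖∑ i, α i • P i v - z‖ := by
        rw [← dist_eq_norm]
        exact Metric.infDist_le_dist_of_mem hz
    _ ≤ Real.sqrt (1 - m / θ ^ 2) * d := by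
        refine le_of_abs_le (abs_le_of_sq_le_sq ?_ (by positivity))
        rw [mul_pow, Real.sq_sqrt (sub_nonneg.2 hm_div), hstep]
        linarith
end

section
/- Let C, D ⊆ ℝ^m be nonempty closed convex sets with C ∩ D ≠ ∅, with metric projections P_C and P_D, and let B ⊆ ℝ^m be a set on which C and D are boundedly linearly regular with constant θ ≥ 1, i.e. dist(v, C ∩ D) ≤ θ·max{dist(v, C), dist(v, D)} for all v ∈ B. Suppose S ∈ B and S⁺ := P_C(P_D(S)) ∈ B (one round of von Neumann's alternating projections). Then dist(S⁺, C ∩ D) ≤ √(1 − 1/θ²)·dist(S, C ∩ D). -/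
open scoped RealInnerProductSpace

section MetricProjection

variable {E : Type*} [NormedAddCommGroup E] [InnerProductSpace ℝ E]

/-- Variational inequality for a nearest point of a convex set. -/
lemma real_inner_sub_nonpos_of_norm_eq_infDist {K : Set E} (hK : Convex ℝ K) {x p : E}
    (hp : p ∈ K) (h : ‖x - p‖ = Metric.infDist x K) {y : E} (hy : y ∈ K) :
    ⟪x - p, y - p⟫ ≤ 0 := by
  refine (norm_eq_iInf_iff_real_inner_le_zero hK hp).1 ?_ y hy
  simpa only [Metric.infDist_eq_iInf, dist_eq_norm] using h

/-- Replacing a point by its nearest point in `K` does not increase the distance to a closed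
subset of `K`. -/
lemma infDist_le_infDist_of_norm_eq_infDist [ProperSpace E] {K A : Set E} (hK : Convex ℝ K)
    (hA : IsClosed A) (hAne : A.Nonempty) (hAK : A ⊆ K) {x p : E}
    (hp : p ∈ K) (h : ‖x - p‖ = Metric.infDist x K) :
    Metric.infDist p A ≤ Metric.infDist x A := by
  obtain ⟨z, hz, hxz⟩ := hA.exists_infDist_eq_dist hAne x
  have hi := real_inner_sub_nonpos_of_norm_eq_infDist hK hp h (hAK hz)
  have hexp : ‖x - z‖ ^ 2 = ‖x - p‖ ^ 2 - 2 * ⟪x - p, z - p⟫ + ‖p - z‖ ^ 2 := by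
    rw [← sub_sub_sub_cancel_right x z p, norm_sub_sq_real, norm_sub_rev z p]
  refine (Metric.infDist_le_dist_of_mem hz).trans ?_
  rw [hxz, dist_eq_norm, dist_eq_norm]
  refine le_of_sq_le_sq ?_ (norm_nonneg _)
  nlinarith [sq_nonneg ‖x - p‖]

/-- If every point of the segment from `0` to `v` has distance at least `‖u‖ / θ` from `u`, and
the angle at `u` of the triangle `0, u, v` is not acute, then the angle at `0` has cosine at most
`√(1 - 1 / θ ^ 2)`. -/
lemma real_inner_sq_le_of_segment_dist {u v : E} {c : ℝ} (huv : ‖u‖ ^ 2 ≤ ⟪u, v⟫)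
    (hseg : ∀ s ∈ Set.Icc (0 : ℝ) 1, c * ‖u‖ ^ 2 ≤ ‖u - s • v‖ ^ 2) :
    ⟪u, v⟫ ^ 2 ≤ (1 - c) * ‖u‖ ^ 2 * ‖v‖ ^ 2 := by
  rcases eq_or_ne v 0 with rfl | hv
  · simp
  have hv2 : 0 < ‖v‖ ^ 2 := by positivity
  have hcs := real_inner_le_norm u v
  have hle : ⟪u, v⟫ ≤ ‖v‖ ^ 2 := by
    nlinarith [sq_nonneg (‖u‖ - ‖v‖)]
  have h0 : 0 ≤ ⟪u, v⟫ := (sq_nonneg _).trans huv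
  have h := hseg (⟪u, v⟫ / ‖v‖ ^ 2) ⟨by positivity, (div_le_one hv2).2 hle⟩
  rw [norm_sub_sq_real, real_inner_smul_right, norm_smul, mul_pow, Real.norm_eq_abs, sq_abs] at h
  have he : ‖u‖ ^ 2 - 2 * (⟪u, v⟫ / ‖v‖ ^ 2 * ⟪u, v⟫) + (⟪u, v⟫ / ‖v‖ ^ 2) ^ 2 * ‖v‖ ^ 2
      = ‖u‖ ^ 2 - ⟪u, v⟫ ^ 2 / ‖v‖ ^ 2 := by
    field_simp
    ring
  rw [he] at h
  have h' : ⟪u, v⟫ ^ 2 / ‖v‖ ^ 2 ≤ (1 - c) * ‖u‖ ^ 2 := by linarith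
  exact (div_le_iff₀ hv2).1 h'

/-- Single projection step: if `x ∈ D`, `w` is the nearest point of `C` to `x`, and
`√c * dist(w, C ∩ D) ≤ dist(w, D)`, then `dist(w, C ∩ D)² ≤ (1 - c) * dist(x, C ∩ D)²`. -/
lemma infDist_inter_sq_le_of_norm_eq_infDist [ProperSpace E] {C D : Set E} (hC : IsClosed C)
    (hCconv : Convex ℝ C) (hD : IsClosed D) (hDconv : Convex ℝ D) (hCD : (C ∩ D).Nonempty)
    {x w : E} (hx : x ∈ D) (hw : w ∈ C) (hxw : ‖x - w‖ = Metric.infDist x C) {c : ℝ}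
    (hc0 : 0 ≤ c) (hc1 : c ≤ 1)
    (hreg : c * Metric.infDist w (C ∩ D) ^ 2 ≤ Metric.infDist w D ^ 2) :
    Metric.infDist w (C ∩ D) ^ 2 ≤ (1 - c) * Metric.infDist x (C ∩ D) ^ 2 := by
  have hconv := hCconv.inter hDconv
  obtain ⟨p, hp, hwp⟩ := (hC.inter hD).exists_infDist_eq_dist hCD w
  obtain ⟨z, hz, hxz⟩ := (hC.inter hD).exists_infDist_eq_dist hCD x
  rw [dist_eq_norm] at hwp hxz
  have hwz := real_inner_sub_nonpos_of_norm_eq_infDist hconv hp hwp.symm hz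
  have hxp := real_inner_sub_nonpos_of_norm_eq_infDist hconv hz hxz.symm hp
  have hCp := real_inner_sub_nonpos_of_norm_eq_infDist hCconv hw hxw hp.1
  have hCz := real_inner_sub_nonpos_of_norm_eq_infDist hCconv hw hxw hz.1
  have hseg : ∀ s ∈ Set.Icc (0 : ℝ) 1, c * ‖w - p‖ ^ 2 ≤ ‖(w - p) - s • (x - p)‖ ^ 2 := by
    intro s hs
    have hmem := hDconv.add_smul_sub_mem hp.2 hx hs
    have hle := Metric.infDist_le_dist_of_mem (x := w) hmem
    rw [dist_eq_norm, ← sub_sub] at hle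
    rw [← hwp]
    exact hreg.trans (pow_le_pow_left₀ Metric.infDist_nonneg hle 2)
  rw [hwp, hxz]
  obtain ⟨u, rfl⟩ : ∃ u, w = p + u := ⟨w - p, by abel⟩
  obtain ⟨v, rfl⟩ : ∃ v, x = p + v := ⟨x - p, by abel⟩
  obtain ⟨k, rfl⟩ : ∃ k, z = p + k := ⟨z - p, by abel⟩
  simp only [add_sub_cancel_left, add_sub_add_left_eq_sub, sub_add_cancel_left] at *
  simp only [inner_sub_left, inner_sub_right, inner_neg_right, real_inner_self_eq_norm_sq,
    real_inner_comm u v] at hwz hxp hCp hCz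
  have hcos := real_inner_sq_le_of_segment_dist (u := u) (v := v) (by linarith) hseg
  rw [norm_sub_sq_real]
  rcases eq_or_ne u 0 with rfl | hu
  · rw [← norm_sub_sq_real]
    simpa using mul_nonneg (sub_nonneg.2 hc1) (sq_nonneg _)
  have hu2 : 0 < ‖u‖ ^ 2 := by positivity
  have hk2 := sq_nonneg ‖k‖
  set q := ⟪v, k⟫
  have hq : ‖k‖ ^ 2 ≤ q := by linarith
  have huv : ‖u‖ ^ 2 + q ≤ ⟪u, v⟫ := by linarith
  have hsq : (‖u‖ ^ 2 + q) ^ 2 ≤ (1 - c) * ‖u‖ ^ 2 * ‖v‖ ^ 2 :=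
    (pow_le_pow_left₀ (by linarith) huv 2).trans hcos
  have hlow : ‖u‖ ^ 2 * (‖u‖ ^ 2 + 2 * q) ≤ ‖u‖ ^ 2 * ((1 - c) * ‖v‖ ^ 2) := by
    nlinarith [sq_nonneg q]
  have hdiv := le_of_mul_le_mul_left hlow hu2
  nlinarith [mul_nonneg hc0 (hk2.trans hq), mul_nonneg (sub_nonneg.2 hc1) hk2]

end MetricProjection


/-- One round of von Neumann's alternating projections contracts the
distance to the intersection: if `C, D ⊆ ℝ^m` are nonempty closed convex with
`C ∩ D ≠ ∅`, boundedly linearly regular on `B` with constant `θ ≥ 1`, `S ∈ B` and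
`S⁺ = P_C(P_D(S)) ∈ B`, then `dist(S⁺, C ∩ D) ≤ √(1 − 1/θ²) · dist(S, C ∩ D)`. -/
theorem stmt_16 {m : ℕ} (C D : Set (EuclideanSpace ℝ (Fin m)))
    (hCne : C.Nonempty) (hCclosed : IsClosed C) (hCconv : Convex ℝ C)
    (hDne : D.Nonempty) (hDclosed : IsClosed D) (hDconv : Convex ℝ D)
    (hCD : (C ∩ D).Nonempty)
    (PC PD : EuclideanSpace ℝ (Fin m) → EuclideanSpace ℝ (Fin m))
    (hPCmem : ∀ x, PC x ∈ C) (hPCdist : ∀ x, ‖x - PC x‖ = Metric.infDist x C)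
    (hPDmem : ∀ x, PD x ∈ D) (hPDdist : ∀ x, ‖x - PD x‖ = Metric.infDist x D)
    (B : Set (EuclideanSpace ℝ (Fin m))) (θ : ℝ) (hθ : 1 ≤ θ)
    (hreg : ∀ v ∈ B, Metric.infDist v (C ∩ D) ≤
      θ * max (Metric.infDist v C) (Metric.infDist v D))
    (S : EuclideanSpace ℝ (Fin m)) (hS : S ∈ B) (hS' : PC (PD S) ∈ B) :
    Metric.infDist (PC (PD S)) (C ∩ D) ≤
      Real.sqrt (1 - 1 / θ ^ 2) * Metric.infDist S (C ∩ D) := by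
  have hθ0 : 0 < θ := by linarith
  have hc1 : 1 / θ ^ 2 ≤ 1 := (div_le_one (by positivity)).2 (one_le_pow₀ hθ)
  have hθS := hreg _ hS'
  rw [Metric.infDist_zero_of_mem (hPCmem _), max_eq_right Metric.infDist_nonneg] at hθS
  have hstep := infDist_inter_sq_le_of_norm_eq_infDist hCclosed hCconv hDclosed hDconv hCD
    (hPDmem S) (hPCmem _) (hPCdist _) (c := 1 / θ ^ 2) (by positivity) hc1 (by
      rw [one_div_mul_eq_div, div_le_iff₀ (by positivity), ← mul_pow, mul_comm _ θ]
      exact pow_le_pow_left₀ Metric.infDist_nonneg hθS 2)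
  have hmono := infDist_le_infDist_of_norm_eq_infDist hDconv (hCclosed.inter hDclosed) hCD
    Set.inter_subset_right (hPDmem S) (hPDdist S)
  calc Metric.infDist (PC (PD S)) (C ∩ D)
      ≤ Real.sqrt ((1 - 1 / θ ^ 2) * Metric.infDist (PD S) (C ∩ D) ^ 2) :=
        Real.le_sqrt_of_sq_le hstep
    _ = Real.sqrt (1 - 1 / θ ^ 2) * Metric.infDist (PD S) (C ∩ D) := by
      rw [Real.sqrt_mul (sub_nonneg.2 hc1), Real.sqrt_sq Metric.infDist_nonneg]
    _ ≤ _ := mul_le_mul_of_nonneg_left hmono (Real.sqrt_nonneg _)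
end
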